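/- Let (E, 𝓛, ℬ) be a weakly left resolving labelled space such that ℬ is closed under relative complements, with associated inverse semigroup S, and let ξ be a filter in E(S) of infinite type. Then ξ is tight if and only if ξ is an ultrafilter. -/

import Mathlib

universe u v w

attribute [local instance] Classical.propDecidable

/-- Elements of the semigroups `T` and `S` associated with a labelled space:
`none` plays the role of the zero element, and `some (α, A, β)` is a triple. -/
abbrev STrip (V : Type u) (L : Type w) := List L × Set V × List L

/-- A labelled graph: a directed graph `(V, Ed, rng, src)` together with a labelling
map `lbl` on edges, over the alphabet `L`. -/
structure LabelledGraph (V : Type u) (Ed : Type v) (L : Type w) where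
  src : Ed → V
  rng : Ed → V
  lbl : Ed → L

namespace LabelledGraph

variable {V : Type u} {Ed : Type v} {L : Type w} (G : LabelledGraph V Ed L)

/-- A (finite) path: a list of edges with matching ranges and sources. -/
def IsPath (p : List Ed) : Prop := p.Chain' (fun e f => G.rng e = G.src f)

/-- `α ∈ 𝓛*(E)`: the labels of finite paths, together with the empty word `[]`. -/
def IsWord (α : List L) : Prop := ∃ p : List Ed, G.IsPath p ∧ p.map G.lbl = α

/-- The relative range `r(A, α)`, with `r(A, ω) = A` for the empty word. -/
def relRange (A : Set V) : List L → Set V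
  | [] => A
  | a :: w =>
      {v | ∃ (p : List Ed) (h : p ≠ []), G.IsPath p ∧ p.map G.lbl = a :: w ∧
        G.src (p.head h) ∈ A ∧ G.rng (p.getLast h) = v}

/-- `r(α) = r(E⁰, α)`. -/
def range (α : List L) : Set V := G.relRange Set.univ α

/-- `ℬ_α = ℬ ∩ 𝒫(r(α))`. -/
def rFam (ℬ : Set (Set V)) (α : List L) : Set (Set V) := {A ∈ ℬ | A ⊆ G.range α}

/-- `ℬ` is accommodating for the labelled graph `G`: closed under relative ranges,
finite intersections and unions, and contains `r(α)` for every nonempty word `α`. -/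
def Accommodating (ℬ : Set (Set V)) : Prop :=
  (∀ A ∈ ℬ, ∀ α : List L, G.IsWord α → G.relRange A α ∈ ℬ) ∧
  (∀ A ∈ ℬ, ∀ B ∈ ℬ, A ∩ B ∈ ℬ) ∧
  (∀ A ∈ ℬ, ∀ B ∈ ℬ, A ∪ B ∈ ℬ) ∧
  (∀ α : List L, α ≠ [] → G.IsWord α → G.range α ∈ ℬ)

/-- The labelled space `(G, ℬ)` is weakly left resolving. -/
def WeaklyLeftResolving (ℬ : Set (Set V)) : Prop :=
  ∀ A ∈ ℬ, ∀ B ∈ ℬ, ∀ α : List L, α ≠ [] →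
    G.relRange (A ∩ B) α = G.relRange A α ∩ G.relRange B α

/-- `ℬ` is closed under relative complements. -/
def ClosedUnderRelComp (ℬ : Set (Set V)) : Prop :=
  ∀ A ∈ ℬ, ∀ B ∈ ℬ, A \ B ∈ ℬ

/-- Membership in the semigroup `T`: either the zero `none`, or a triple `(α, A, β)`
with `α, β ∈ 𝓛*(E)` and `A ∈ ℬ_α ∩ ℬ_β`. -/
def ValidT (ℬ : Set (Set V)) (t : Option (STrip V L)) : Prop :=
  ∀ x ∈ t, G.IsWord x.1 ∧ G.IsWord x.2.2 ∧ x.2.1 ∈ G.rFam ℬ x.1 ∧ x.2.1 ∈ G.rFam ℬ x.2.2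

/-- Membership in the inverse semigroup `S`: as in `T`, but triples with empty middle
set are identified with the zero, so nonzero elements have nonempty middle set. -/
def ValidS (ℬ : Set (Set V)) (t : Option (STrip V L)) : Prop :=
  G.ValidT ℬ t ∧ ∀ x ∈ t, x.2.1 ≠ (∅ : Set V)

/-- The product on `T`. -/
noncomputable def mulT : Option (STrip V L) → Option (STrip V L) → Option (STrip V L)
  | some (α, A, β), some (γ, B, δ) =>
      if β <+: γ then
        some (α ++ γ.drop β.length, G.relRange A (γ.drop β.length) ∩ B, δ)
      else if γ <+: β then
        some (α, A ∩ G.relRange B (β.drop γ.length), δ ++ β.drop γ.length)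
      else none
  | _, _ => none

/-- The product on `S`: the product of `T`, with triples having empty middle set
collapsed to the zero element. -/
noncomputable def mulS (s t : Option (STrip V L)) : Option (STrip V L) :=
  match G.mulT s t with
  | none => none
  | some (α, A, β) => if A = (∅ : Set V) then none else some (α, A, β)

/-- A nonzero idempotent `(α, A, α)` of `S`, represented as the pair `(α, A)`. -/
def ValidE (ℬ : Set (Set V)) (p : List L × Set V) : Prop :=
  G.IsWord p.1 ∧ p.2 ∈ G.rFam ℬ p.1 ∧ p.2 ≠ (∅ : Set V)

/-- The natural order on nonzero idempotents of `S`: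
`(α, A, α) ≤ (β, B, β)` iff `α = βγ` and `A ⊆ r(B, γ)`. -/
def esLe (p q : List L × Set V) : Prop :=
  ∃ γ : List L, p.1 = q.1 ++ γ ∧ p.2 ⊆ G.relRange q.2 γ

/-- `p ∧ q ≠ 0` for nonzero idempotents `p`, `q` of `S`. -/
def meetNeZero (p q : List L × Set V) : Prop :=
  (∃ γ : List L, q.1 = p.1 ++ γ ∧ (G.relRange p.2 γ ∩ q.2).Nonempty) ∨
  (∃ γ : List L, p.1 = q.1 ++ γ ∧ (p.2 ∩ G.relRange q.2 γ).Nonempty)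

/-- A filter in the semilattice `E(S)`, identified with its set of (nonzero) elements:
nonempty, not containing `0`, upward closed and downward directed. -/
def IsFilterES (ℬ : Set (Set V)) (ξ : Set (List L × Set V)) : Prop :=
  ξ.Nonempty ∧ (∀ p ∈ ξ, G.ValidE ℬ p) ∧
  (∀ p ∈ ξ, ∀ q, G.ValidE ℬ q → G.esLe p q → q ∈ ξ) ∧
  (∀ p ∈ ξ, ∀ q ∈ ξ, ∃ z ∈ ξ, G.esLe z p ∧ G.esLe z q)

/-- An ultrafilter in `E(S)`: a filter not properly contained in any filter. -/
def IsUltraES (ℬ : Set (Set V)) (ξ : Set (List L × Set V)) : Prop :=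
  G.IsFilterES ℬ ξ ∧ ∀ η, G.IsFilterES ℬ η → ξ ⊆ η → ξ = η

/-- `Z` is a cover for `x` in `E(S)`: `Z ⊆ ↓x` and every nonzero `y ≤ x` meets some
element of `Z` nontrivially. -/
def IsCover (ℬ : Set (Set V)) (Z : Set (List L × Set V)) (x : List L × Set V) : Prop :=
  (∀ z ∈ Z, G.ValidE ℬ z ∧ G.esLe z x) ∧
  ∀ y, G.ValidE ℬ y → G.esLe y x → ∃ z ∈ Z, G.meetNeZero z y

/-- A tight filter in `E(S)`: a filter meeting every finite cover of each of its
elements. -/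
def IsTight (ℬ : Set (Set V)) (ξ : Set (List L × Set V)) : Prop :=
  G.IsFilterES ℬ ξ ∧
  ∀ x ∈ ξ, ∀ Z : Set (List L × Set V), Z.Finite → G.IsCover ℬ Z x → (Z ∩ ξ).Nonempty

/-- A filter in a family `𝒞` of subsets of `V` (e.g. `ℬ_α`), ordered by inclusion
with least element `∅`. -/
def IsFilterIn (𝒞 F : Set (Set V)) : Prop :=
  F.Nonempty ∧ F ⊆ 𝒞 ∧ (∅ : Set V) ∉ F ∧
  (∀ A ∈ F, ∀ B ∈ 𝒞, A ⊆ B → B ∈ F) ∧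
  (∀ A ∈ F, ∀ B ∈ F, ∃ C ∈ F, C ⊆ A ∧ C ⊆ B)

/-- An ultrafilter in a family `𝒞` of subsets of `V`. -/
def IsUltraIn (𝒞 F : Set (Set V)) : Prop :=
  IsFilterIn 𝒞 F ∧ ∀ F', IsFilterIn 𝒞 F' → F ⊆ F' → F = F'

/-- `α ∈ 𝓛^∞(E)`: labels of infinite paths. -/
def IsInfWord (α : ℕ → L) : Prop :=
  ∃ p : ℕ → Ed, (∀ n, G.rng (p n) = G.src (p (n + 1))) ∧ ∀ n, G.lbl (p n) = α n

end LabelledGraph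

/-- `α_{n+1, m}` (in the 1-indexed notation of the paper): the finite subword of the
infinite word `α` consisting of its letters at (0-indexed) positions `n, …, m-1`. -/
def LabelledGraph.seg {L : Type w} (α : ℕ → L) (n m : ℕ) : List L :=
  (List.range (m - n)).map fun i => α (n + i)

/-- `α_{1, n}`: the first `n` letters of the infinite word `α`. -/
def LabelledGraph.prefixN {L : Type w} (α : ℕ → L) (n : ℕ) : List L :=
  LabelledGraph.seg α 0 n

namespace LabelledGraph

variable {V : Type u} {Ed : Type v} {L : Type w} (G : LabelledGraph V Ed L)

/-- A family `{F n}` as in the paper: `F n` is a filter in `ℬ_{α_{1,n}}` for `n > 0`,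
and `F 0` is a filter in `ℬ` or empty. -/
def IsFam (ℬ : Set (Set V)) (α : ℕ → L) (F : ℕ → Set (Set V)) : Prop :=
  (∀ n, 0 < n → IsFilterIn (G.rFam ℬ (prefixN α n)) (F n)) ∧
  (F 0 = ∅ ∨ IsFilterIn (G.rFam ℬ (prefixN α 0)) (F 0))

/-- An admissible family for the infinite word `α`. -/
def Admissible (ℬ : Set (Set V)) (α : ℕ → L) (F : ℕ → Set (Set V)) : Prop :=
  G.IsFam ℬ α F ∧
  ∀ n, F n ⊆ {A ∈ G.rFam ℬ (prefixN α n) | G.relRange A [α n] ∈ F (n + 1)}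

/-- A complete family for the infinite word `α`. -/
def Complete (ℬ : Set (Set V)) (α : ℕ → L) (F : ℕ → Set (Set V)) : Prop :=
  G.IsFam ℬ α F ∧
  ∀ n, F n = {A ∈ G.rFam ℬ (prefixN α n) | G.relRange A [α n] ∈ F (n + 1)}

/-- The subset `⋃_{n} ⋃_{A ∈ F n} ↑(α_{1,n}, A, α_{1,n})` of `E(S)` determined by an
infinite word `α` and a family `{F n}`. -/
def filtOfFam (ℬ : Set (Set V)) (α : ℕ → L) (F : ℕ → Set (Set V)) :
    Set (List L × Set V) :=
  {q | G.ValidE ℬ q ∧ ∃ n, ∃ A ∈ F n, G.esLe (prefixN α n, A) q}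

/-- The prefix `α_{1,n}` of a finite-or-infinite word. -/
def wTake : List L ⊕ (ℕ → L) → ℕ → List L
  | Sum.inl w, n => w.take n
  | Sum.inr α, n => prefixN α n

/-- `n ≤ |α|` for a finite-or-infinite word `α`. -/
def wLe (n : ℕ) : List L ⊕ (ℕ → L) → Prop
  | Sum.inl w => n ≤ w.length
  | Sum.inr _ => True

/-- The finite-or-infinite word is a labelled path (`𝓛*(E) ∪ 𝓛^∞(E)`). -/
def wGood : List L ⊕ (ℕ → L) → Prop
  | Sum.inl w => G.IsWord w
  | Sum.inr α => G.IsInfWord α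

/-- `α` is a beginning of (or equal to) `β`, for finite-or-infinite words. -/
def wBeg : List L ⊕ (ℕ → L) → List L ⊕ (ℕ → L) → Prop
  | Sum.inl a, Sum.inl b => a <+: b
  | Sum.inl a, Sum.inr β => a = prefixN β a.length
  | Sum.inr α, Sum.inr β => α = β
  | Sum.inr _, Sum.inl _ => False

/-- The word associated with a filter `ξ` in `E(S)`: for a finite word `w`, `w`
appears in `ξ` and has the largest length; for an infinite word `α`, the words of
elements of `ξ` are beginnings of `α`, of unbounded length. -/
def HasWord (ξ : Set (List L × Set V)) : List L ⊕ (ℕ → L) → Prop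
  | Sum.inl w => (∃ A, (w, A) ∈ ξ) ∧ ∀ p ∈ ξ, p.1.length ≤ w.length
  | Sum.inr α => (∀ p ∈ ξ, ∃ n, p.1 = prefixN α n) ∧ ∀ n, ∃ p ∈ ξ, n ≤ p.1.length

end LabelledGraph
namespace LabelledGraph

section Helpers

variable {V : Type u} {Ed : Type v} {L : Type w}

theorem aux_relRange_cons (G : LabelledGraph V Ed L) (A : Set V) (a : L) (w : List L) :
    G.relRange A (a :: w) =
      G.relRange {v | ∃ e, G.src e ∈ A ∧ G.lbl e = a ∧ G.rng e = v} w := by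
  ext v
  cases w with
  | nil =>
    constructor
    · rintro ⟨p, h, hp, hm, hs, hr⟩
      match p, h with
      | [e], _ =>
        simp at hm
        exact ⟨e, hs, hm, hr⟩
      | e :: f :: p, _ => simp at hm
    · rintro ⟨e, hs, hm, hr⟩
      refine ⟨[e], by simp, ?_, by simp [hm], hs, hr⟩
      exact List.isChain_singleton e
  | cons b w =>
    constructor
    · rintro ⟨p, h, hp, hm, hs, hr⟩
      match p, h with
      | [e], _ => simp at hm
      | e :: f :: p, _ =>
        simp only [List.map_cons, List.cons.injEq] at hm
        have hp' := List.isChain_cons_cons.1 hp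
        refine ⟨f :: p, by simp, hp'.2, by simp [hm.2], ⟨e, hs, hm.1, hp'.1⟩, ?_⟩
        simpa using hr
    · rintro ⟨p, h, hp, hm, ⟨e, hs, hl, hre⟩, hr⟩
      match p, h with
      | f :: p, _ =>
        refine ⟨e :: f :: p, by simp, List.isChain_cons_cons.2 ⟨hre, hp⟩, ?_, hs, ?_⟩
        · rw [List.map_cons, hm, hl]
        · simpa using hr

theorem aux_relRange_append (G : LabelledGraph V Ed L) (γ δ : List L) (A : Set V) :
    G.relRange A (γ ++ δ) = G.relRange (G.relRange A γ) δ := by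
  induction γ generalizing A with
  | nil => rfl
  | cons a w ih => rw [List.cons_append, aux_relRange_cons, ih, ← aux_relRange_cons]

theorem aux_relRange_mono (G : LabelledGraph V Ed L) {A B : Set V} (h : A ⊆ B) (γ : List L) :
    G.relRange A γ ⊆ G.relRange B γ := by
  cases γ with
  | nil => exact h
  | cons a w =>
    rintro v ⟨p, hn, hp, hm, hs, hr⟩
    exact ⟨p, hn, hp, hm, h hs, hr⟩

theorem aux_relRange_union (G : LabelledGraph V Ed L) (A B : Set V) (γ : List L) :
    G.relRange (A ∪ B) γ ⊆ G.relRange A γ ∪ G.relRange B γ := by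
  cases γ with
  | nil => exact subset_rfl
  | cons a w =>
    rintro v ⟨p, hn, hp, hm, hs | hs, hr⟩
    · exact Or.inl ⟨p, hn, hp, hm, hs, hr⟩
    · exact Or.inr ⟨p, hn, hp, hm, hs, hr⟩

theorem aux_relRange_empty (G : LabelledGraph V Ed L) (γ : List L) :
    G.relRange (∅ : Set V) γ = ∅ := by
  cases γ with
  | nil => rfl
  | cons a w =>
    ext v
    constructor
    · rintro ⟨p, hn, hp, hm, hs, hr⟩
      exact hs.elim
    · exact fun h => h.elim

theorem aux_relRange_inter {G : LabelledGraph V Ed L} {ℬ : Set (Set V)}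
    (hwlr : G.WeaklyLeftResolving ℬ) {A B : Set V} (hA : A ∈ ℬ) (hB : B ∈ ℬ) (γ : List L) :
    G.relRange (A ∩ B) γ = G.relRange A γ ∩ G.relRange B γ := by
  cases γ with
  | nil => rfl
  | cons a w => exact hwlr A hA B hB _ (by simp)

theorem aux_isWord_suffix {G : LabelledGraph V Ed L} {α β : List L} (h : G.IsWord (α ++ β)) :
    G.IsWord β := by
  obtain ⟨p, hp, hm⟩ := h
  obtain ⟨p1, p2, rfl, h1, h2⟩ := List.map_eq_append_iff.1 hm
  exact ⟨p2, (List.isChain_append.1 hp).2.1, h2⟩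

theorem aux_esLe_refl (G : LabelledGraph V Ed L) (p : List L × Set V) : G.esLe p p :=
  ⟨[], by simp, subset_rfl⟩

theorem aux_esLe_trans {G : LabelledGraph V Ed L} {p q r : List L × Set V}
    (h1 : G.esLe p q) (h2 : G.esLe q r) : G.esLe p r := by
  obtain ⟨a, ha, ha'⟩ := h1
  obtain ⟨b, hb, hb'⟩ := h2
  refine ⟨b ++ a, by rw [ha, hb, List.append_assoc], ?_⟩
  rw [aux_relRange_append]
  exact ha'.trans (aux_relRange_mono G hb' a)

theorem aux_relRange_mem {G : LabelledGraph V Ed L} {ℬ : Set (Set V)}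
    (hacc : G.Accommodating ℬ) {A : Set V} (hA : A ∈ ℬ) {β γ : List L}
    (h : G.IsWord (β ++ γ)) : G.relRange A γ ∈ ℬ :=
  hacc.1 A hA γ (aux_isWord_suffix h)

/-- The explicit meet of two idempotents. -/
theorem aux_meet_valid {G : LabelledGraph V Ed L} {ℬ : Set (Set V)}
    (hacc : G.Accommodating ℬ) {p q : List L × Set V} (hp : G.ValidE ℬ p) (hq : G.ValidE ℬ q)
    {γ : List L} (h : q.1 = p.1 ++ γ) (hne : (G.relRange p.2 γ ∩ q.2).Nonempty) :
    G.ValidE ℬ (q.1, G.relRange p.2 γ ∩ q.2) := by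
  refine ⟨hq.1, ⟨hacc.2.1 _ ?_ _ hq.2.1.1, Set.inter_subset_right.trans hq.2.1.2⟩, hne.ne_empty⟩
  have := hq.1
  rw [h] at this
  exact aux_relRange_mem hacc hp.2.1.1 this

theorem aux_le_nonempty {G : LabelledGraph V Ed L} {ℬ : Set (Set V)}
    (hacc : G.Accommodating ℬ) (hwlr : G.WeaklyLeftResolving ℬ)
    {p q m : List L × Set V} (hp : G.ValidE ℬ p) (hq : G.ValidE ℬ q) (hm : G.ValidE ℬ m)
    {ε : List L} (h : q.1 = p.1 ++ ε)
    (h1 : G.esLe m p) (h2 : G.esLe m q) : (G.relRange p.2 ε ∩ q.2).Nonempty := by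
  obtain ⟨a, ha, ha'⟩ := h1
  obtain ⟨b, hb, hb'⟩ := h2
  have hab : a = ε ++ b := by
    rw [ha, h, List.append_assoc] at hb
    exact List.append_cancel_left hb
  rw [hab, aux_relRange_append] at ha'
  have hmem : G.relRange p.2 ε ∈ ℬ := by
    have := hq.1
    rw [h] at this
    exact aux_relRange_mem hacc hp.2.1.1 this
  by_contra hcon
  rw [Set.not_nonempty_iff_eq_empty] at hcon
  have hI := aux_relRange_inter hwlr hmem hq.2.1.1 b
  rw [hcon, aux_relRange_empty] at hI
  apply hm.2.2
  rw [← Set.subset_empty_iff, hI]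
  exact Set.subset_inter ha' hb'

theorem aux_meet_iff {G : LabelledGraph V Ed L} {ℬ : Set (Set V)}
    (hacc : G.Accommodating ℬ) (hwlr : G.WeaklyLeftResolving ℬ)
    {p q : List L × Set V} (hp : G.ValidE ℬ p) (hq : G.ValidE ℬ q) :
    G.meetNeZero p q ↔ ∃ m, G.ValidE ℬ m ∧ G.esLe m p ∧ G.esLe m q := by
  constructor
  · rintro (⟨γ, h, hne⟩ | ⟨γ, h, hne⟩)
    · exact ⟨_, aux_meet_valid hacc hp hq h hne, ⟨γ, h, Set.inter_subset_left⟩,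
        ⟨[], by simp, Set.inter_subset_right⟩⟩
    · rw [Set.inter_comm] at hne
      exact ⟨_, aux_meet_valid hacc hq hp h hne, ⟨[], by simp, Set.inter_subset_right⟩,
        ⟨γ, h, Set.inter_subset_left⟩⟩
  · rintro ⟨m, hm, h1, h2⟩
    obtain ⟨a, ha, -⟩ := id h1
    obtain ⟨b, hb, -⟩ := id h2
    rcases List.append_eq_append_iff.1 (ha.symm.trans hb) with ⟨ε, h, -⟩ | ⟨ε, h, -⟩
    · exact Or.inl ⟨ε, h, aux_le_nonempty hacc hwlr hp hq hm h h1 h2⟩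
    · refine Or.inr ⟨ε, h, ?_⟩
      rw [Set.inter_comm]
      exact aux_le_nonempty hacc hwlr hq hp hm h h2 h1

theorem aux_long {ξ : Set (List L × Set V)} (hne : ξ.Nonempty)
    (hinf : ∀ p ∈ ξ, ∃ q ∈ ξ, p.1.length < q.1.length) (n : ℕ) :
    ∃ q ∈ ξ, n ≤ q.1.length := by
  induction n with
  | zero => exact ⟨_, hne.choose_spec, Nat.zero_le _⟩
  | succ n ih =>
    obtain ⟨q, hq, hn⟩ := ih
    obtain ⟨q', hq', hn'⟩ := hinf q hq
    exact ⟨q', hq', by omega⟩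

theorem aux_esLe_length {G : LabelledGraph V Ed L} {p q : List L × Set V} (h : G.esLe p q) :
    q.1.length ≤ p.1.length := by
  obtain ⟨γ, h, -⟩ := h
  rw [h]
  simp

/-- A common lower bound of `p` and `q` makes the shorter word a prefix. -/
theorem aux_prefix {G : LabelledGraph V Ed L} {p q m : List L × Set V}
    (h1 : G.esLe m p) (h2 : G.esLe m q) (hl : p.1.length ≤ q.1.length) :
    ∃ γ, q.1 = p.1 ++ γ := by
  obtain ⟨a, ha, -⟩ := h1
  obtain ⟨b, hb, -⟩ := h2
  obtain ⟨c, hc⟩ := List.prefix_of_prefix_length_le ⟨a, ha.symm⟩ ⟨b, hb.symm⟩ hl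
  exact ⟨c, hc.symm⟩

theorem aux_ultra_mem {G : LabelledGraph V Ed L} {ℬ : Set (Set V)}
    (hacc : G.Accommodating ℬ) (hwlr : G.WeaklyLeftResolving ℬ)
    {ξ : Set (List L × Set V)} (hξ : G.IsUltraES ℬ ξ)
    (hinf : ∀ p ∈ ξ, ∃ q ∈ ξ, p.1.length < q.1.length)
    {z : List L × Set V} (hz : G.ValidE ℬ z) (hmeet : ∀ y ∈ ξ, G.meetNeZero z y) : z ∈ ξ := by
  obtain ⟨⟨hne, hval, hup, hdir⟩, hmax⟩ := hξ
  have key : ∀ y ∈ ξ, ∀ γ, y.1 = z.1 ++ γ → (G.relRange z.2 γ ∩ y.2).Nonempty := by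
    intro y hy γ h
    obtain ⟨m, hm, h1, h2⟩ := (aux_meet_iff hacc hwlr hz (hval y hy)).1 (hmeet y hy)
    exact aux_le_nonempty hacc hwlr hz (hval y hy) hm h h1 h2
  have long : ∀ y ∈ ξ, z.1.length ≤ y.1.length → ∃ γ, y.1 = z.1 ++ γ := by
    intro y hy hl
    obtain ⟨m, hm, h1, h2⟩ := (aux_meet_iff hacc hwlr hz (hval y hy)).1 (hmeet y hy)
    exact aux_prefix h1 h2 hl
  obtain ⟨y0, hy0, hl0⟩ := aux_long hne hinf z.1.length
  obtain ⟨γ0, hγ0⟩ := long y0 hy0 hl0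
  let η : Set (List L × Set V) := {q | G.ValidE ℬ q ∧ ∃ y ∈ ξ, ∃ γ, y.1 = z.1 ++ γ ∧
    G.esLe (y.1, G.relRange z.2 γ ∩ y.2) q}
  have hzη : z ∈ η := ⟨hz, y0, hy0, γ0, hγ0, γ0, hγ0, Set.inter_subset_left⟩
  have hη : G.IsFilterES ℬ η := by
    refine ⟨⟨z, hzη⟩, fun p hp => hp.1, ?_, ?_⟩
    · rintro p ⟨-, y, hy, γ, h, hle⟩ q hq hpq
      exact ⟨hq, y, hy, γ, h, aux_esLe_trans hle hpq⟩
    · rintro p ⟨-, y1, hy1, γ1, h1, hle1⟩ q ⟨-, y2, hy2, γ2, h2, hle2⟩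
      obtain ⟨y, hy, hyy1, hyy2⟩ := hdir y1 hy1 y2 hy2
      have hl : z.1.length ≤ y.1.length := by
        have := aux_esLe_length hyy1
        rw [h1] at this
        simp at this
        omega
      obtain ⟨γ, h⟩ := long y hy hl
      have low : ∀ y' ∈ ξ, ∀ γ', y'.1 = z.1 ++ γ' → G.esLe y y' →
          G.esLe (y.1, G.relRange z.2 γ ∩ y.2) (y'.1, G.relRange z.2 γ' ∩ y'.2) := by
        rintro y' hy' γ' h' ⟨δ, hδ, hsub⟩
        have hγ : γ = γ' ++ δ := by
          rw [h, h', List.append_assoc] at hδ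
          exact List.append_cancel_left hδ
        refine ⟨δ, hδ, ?_⟩
        have hmem : G.relRange z.2 γ' ∈ ℬ := by
          have := (hval y' hy').1
          rw [h'] at this
          exact aux_relRange_mem hacc hz.2.1.1 this
        simp only
        rw [aux_relRange_inter hwlr hmem (hval y' hy').2.1.1, hγ, aux_relRange_append]
        exact Set.inter_subset_inter_right _ hsub
      exact ⟨_, ⟨aux_meet_valid hacc hz (hval y hy) h (key y hy γ h), y, hy, γ, h,
        aux_esLe_refl G _⟩, aux_esLe_trans (low y1 hy1 γ1 h1 hyy1) hle1,
        aux_esLe_trans (low y2 hy2 γ2 h2 hyy2) hle2⟩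
  have hsub : ξ ⊆ η := by
    intro p hp
    obtain ⟨y, hy, hyp, hyy⟩ := hdir p hp y0 hy0
    obtain ⟨γ, h⟩ := long y hy (hl0.trans (aux_esLe_length hyy))
    refine ⟨hval p hp, y, hy, γ, h, aux_esLe_trans ?_ hyp⟩
    exact ⟨[], by simp, Set.inter_subset_right⟩
  rw [hmax η hη hsub]
  exact hzη

theorem aux_ultra_tight {G : LabelledGraph V Ed L} {ℬ : Set (Set V)}
    (hacc : G.Accommodating ℬ) (hwlr : G.WeaklyLeftResolving ℬ)
    {ξ : Set (List L × Set V)} (hξ : G.IsUltraES ℬ ξ)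
    (hinf : ∀ p ∈ ξ, ∃ q ∈ ξ, p.1.length < q.1.length) : G.IsTight ℬ ξ := by
  refine ⟨hξ.1, fun x hx Z hZ hcov => ?_⟩
  by_contra hcon
  have hz : ∀ z ∈ Z, ∃ y ∈ ξ, ¬ G.meetNeZero z y := by
    intro z hz
    by_contra hc
    push Not at hc
    exact hcon ⟨z, hz, aux_ultra_mem hacc hwlr hξ hinf (hcov.1 z hz).1 hc⟩
  have hlow : ∀ W : Set (List L × Set V), W.Finite → W ⊆ Z →
      ∃ y ∈ ξ, G.esLe y x ∧ ∀ z ∈ W, ¬ G.meetNeZero z y := by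
    intro W hW
    induction W, hW using Set.Finite.induction_on with
    | empty => exact fun _ => ⟨x, hx, aux_esLe_refl G x, fun z hz => hz.elim⟩
    | @insert a s _ _ ih =>
      intro hs
      obtain ⟨y, hy, hyx, hys⟩ := ih ((Set.subset_insert a s).trans hs)
      obtain ⟨y', hy', hna⟩ := hz a (hs (Set.mem_insert a s))
      obtain ⟨w, hw, hwy, hwy'⟩ := hξ.1.2.2.2 y hy y' hy'
      have mono : ∀ u ∈ ξ, G.esLe w u → ∀ t ∈ Z, G.meetNeZero t w → G.meetNeZero t u := by
        intro u hu hwu t ht hmt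
        have htv := (hcov.1 t ht).1
        obtain ⟨m, hm, h1, h2⟩ := (aux_meet_iff hacc hwlr htv (hξ.1.2.1 w hw)).1 hmt
        exact (aux_meet_iff hacc hwlr htv (hξ.1.2.1 u hu)).2
          ⟨m, hm, h1, aux_esLe_trans h2 hwu⟩
      refine ⟨w, hw, aux_esLe_trans hwy hyx, ?_⟩
      rintro t (rfl | ht) hmt
      · exact hna (mono y' hy' hwy' t (hs (Set.mem_insert t s)) hmt)
      · exact hys t ht (mono y hy hwy t (hs (Set.mem_insert_of_mem _ ht)) hmt)
  obtain ⟨y, hy, hyx, hn⟩ := hlow Z hZ subset_rfl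
  obtain ⟨z, hz, hm⟩ := hcov.2 y (hξ.1.2.1 y hy) hyx
  exact hn z hz hm

theorem aux_tight_ultra {G : LabelledGraph V Ed L} {ℬ : Set (Set V)}
    (hacc : G.Accommodating ℬ) (hwlr : G.WeaklyLeftResolving ℬ)
    (hrc : ClosedUnderRelComp ℬ)
    {ξ : Set (List L × Set V)} (hξ : G.IsTight ℬ ξ)
    (hinf : ∀ p ∈ ξ, ∃ q ∈ ξ, p.1.length < q.1.length) : G.IsUltraES ℬ ξ := by
  refine ⟨hξ.1, fun η hη hsub => hsub.antisymm fun p hp => ?_⟩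
  obtain ⟨q, hq, hl⟩ := aux_long hξ.1.1 hinf p.1.length
  obtain ⟨m, hm, hmp, hmq⟩ := hη.2.2.2 p hp q (hsub hq)
  obtain ⟨γ, h⟩ := aux_prefix hmp hmq hl
  have hpv := hη.2.1 p hp
  have hqv := hξ.1.2.1 q hq
  have hmem : G.relRange p.2 γ ∈ ℬ := by
    have := hqv.1
    rw [h] at this
    exact aux_relRange_mem hacc hpv.2.1.1 this
  let z1 : List L × Set V := (q.1, G.relRange p.2 γ ∩ q.2)
  let z2 : List L × Set V := (q.1, q.2 \ G.relRange p.2 γ)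
  let Z : Set (List L × Set V) := {z | (z = z1 ∨ z = z2) ∧ z.2.Nonempty}
  have hz1 : z1.2.Nonempty → G.ValidE ℬ z1 := fun hne => aux_meet_valid hacc hpv hqv h hne
  have hz2 : z2.2.Nonempty → G.ValidE ℬ z2 := fun hne =>
    ⟨hqv.1, ⟨hrc _ hqv.2.1.1 _ hmem, Set.diff_subset.trans hqv.2.1.2⟩, hne.ne_empty⟩
  have hfin : Z.Finite := by
    refine Set.Finite.subset (Set.toFinite {z1, z2}) ?_
    rintro z ⟨hz, -⟩
    exact hz
  have hcov : G.IsCover ℬ Z q := by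
    constructor
    · rintro z ⟨rfl | rfl, hne⟩
      · exact ⟨hz1 hne, [], by simp [z1], Set.inter_subset_right⟩
      · exact ⟨hz2 hne, [], by simp [z2], Set.diff_subset⟩
    · rintro y hy ⟨δ, hδ, hs⟩
      obtain ⟨v, hv⟩ := Set.nonempty_iff_ne_empty.2 hy.2.2
      have hv' := hs hv
      have hun : q.2 = (G.relRange p.2 γ ∩ q.2) ∪ (q.2 \ G.relRange p.2 γ) := by
        rw [Set.inter_comm, Set.inter_union_diff]
      rw [hun] at hv'
      have hne : ∀ B : Set V, v ∈ G.relRange B δ → B.Nonempty := by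
        intro B hB
        rw [Set.nonempty_iff_ne_empty]
        rintro rfl
        rw [aux_relRange_empty] at hB
        exact hB
      rcases aux_relRange_union G _ _ δ hv' with h1 | h1
      · exact ⟨z1, ⟨Or.inl rfl, hne _ h1⟩, Or.inl ⟨δ, hδ, v, h1, hv⟩⟩
      · exact ⟨z2, ⟨Or.inr rfl, hne _ h1⟩, Or.inl ⟨δ, hδ, v, h1, hv⟩⟩
  obtain ⟨z, ⟨hz | hz, hne⟩, hzξ⟩ := hξ.2 q hq Z hfin hcov
  · refine hξ.1.2.2.1 z hzξ p hpv ?_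
    rw [hz]
    exact ⟨γ, h, Set.inter_subset_left⟩
  · exfalso
    obtain ⟨w, hw, hwp, hwz⟩ := hη.2.2.2 p hp z (hsub hzξ)
    subst hz
    obtain ⟨v, hv1, hv2⟩ := aux_le_nonempty hacc hwlr hpv (hz2 hne) (hη.2.1 w hw)
      (show z2.1 = p.1 ++ γ from h) hwp hwz
    exact hv2.2 hv1

end Helpers

/-- Suppose `ℬ` is moreover closed under relative complements.
A filter `ξ` in `E(S)` of infinite type (no word of an element of `ξ` has maximal
length) is tight iff it is an ultrafilter. -/
theorem tight_iff_ultra_infinite_type {V : Type u} {Ed : Type v} {L : Type w}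
    [Nonempty V] [Countable V] [Nonempty Ed] [Countable Ed]
    (G : LabelledGraph V Ed L) (ℬ : Set (Set V))
    (hacc : G.Accommodating ℬ) (hwlr : G.WeaklyLeftResolving ℬ)
    (hrc : ClosedUnderRelComp ℬ)
    (ξ : Set (List L × Set V)) (hξ : G.IsFilterES ℬ ξ)
    (hinf : ∀ p ∈ ξ, ∃ q ∈ ξ, p.1.length < q.1.length) :
    G.IsTight ℬ ξ ↔ G.IsUltraES ℬ ξ := by
  exact ⟨fun h => aux_tight_ultra hacc hwlr hrc h hinf,
    fun h => aux_ultra_tight hacc hwlr h hinf⟩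

end LabelledGraph
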